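/- For all computable real numbers t > r ≥ 0 there exists a constructive t-gale d' that is successively optimal for the class of constructive r-supergales; that is, S∞[d] ⊆ S∞[d'] for every constructive r-supergale d. -/

import Mathlib

open Filter

/-- The length-`n` prefix `S[0..n-1]` of an infinite binary sequence `S`. -/
def preSeq (S : ℕ → Bool) (n : ℕ) : List Bool := (List.range n).map S

/-- An `s`-supergale: a nonnegative function on binary strings with
    `d w ≥ (d w0 + d w1) / 2^s`. -/
def Supergale (s : ℝ) (d : List Bool → ℝ) : Prop :=
  (∀ w, 0 ≤ d w) ∧
  ∀ w : List Bool, (d (w ++ [false]) + d (w ++ [true])) / 2 ^ s ≤ d w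

/-- An `s`-gale: a nonnegative function on binary strings with
    `d w = (d w0 + d w1) / 2^s`. -/
def Gale (s : ℝ) (d : List Bool → ℝ) : Prop :=
  (∀ w, 0 ≤ d w) ∧
  ∀ w : List Bool, d w = (d (w ++ [false]) + d (w ++ [true])) / 2 ^ s

/-- The success set `S∞[d]`: the sequences on whose prefixes `d` has limsup `∞`. -/
def SuccessSet (d : List Bool → ℝ) : Set (ℕ → Bool) :=
  {S | limsup (fun n => ((d (preSeq S n) : ℝ) : EReal)) atTop = ⊤}

/-- A real number is computable if some computable rational sequence
    approximates it to within `2 ^ (-n)`. -/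
def ComputableReal (r : ℝ) : Prop :=
  ∃ f : ℕ → ℚ, Computable f ∧ ∀ n : ℕ, |(f n : ℝ) - r| ≤ 2 ^ (-(n : ℝ))

/-- A function on binary strings is constructive if it is approximable from
    below by a computable rational function, nondecreasing and strictly below
    `g` in its second argument, with supremum `g w`. -/
def Constructive (g : List Bool → ℝ) : Prop :=
  ∃ h : List Bool × ℕ → ℚ, Computable h ∧
    (∀ w n, h (w, n) ≤ h (w, n + 1) ∧ ((h (w, n) : ℝ) < g w)) ∧
    ∀ w, g w = ⨆ n : ℕ, ((h (w, n) : ℝ))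

open Encodable

theorem Computable.of_graph {α : Type*} [Primcodable α] {f : α → ℕ} {p : α → ℕ → Bool}
    (hp : Computable₂ p) (hf : ∀ a x, p a x = true ↔ x = f a) : Computable f := by
  have h : Partrec fun a => Nat.rfind fun n => Part.some (p a n) := Partrec.rfind hp.partrec₂
  refine h.of_eq_tot fun a => ?_
  refine Nat.mem_rfind.2 ⟨by simp [(hf a _).2], fun {m} hm => ?_⟩
  have : ¬ p a m = true := fun h => hm.ne ((hf a m).1 h)
  simpa using this

theorem Computable.nat_count {α : Type*} [Primcodable α] {p : α → ℕ → Bool}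
    (hp : Computable₂ p) : Computable₂ fun a n => Nat.count (fun x => p a x = true) n := by
  have h : Computable fun b : α × ℕ =>
      (Nat.rec 0 (fun n c => bif p b.1 n then c + 1 else c) b.2 : ℕ) := by
    refine Computable.nat_rec (f := Prod.snd) (g := fun _ : α × ℕ => 0)
      (h := fun b c => bif p b.1 c.1 then c.2 + 1 else c.2) Computable.snd (Computable.const 0)
      (Computable₂.mk ?_)
    exact Computable.cond (c := fun c : (α × ℕ) × ℕ × ℕ => p c.1.1 c.2.1)
      (hp.comp (Computable.fst.comp Computable.fst) (Computable.fst.comp Computable.snd))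
      (Computable.succ.comp (Computable.snd.comp Computable.snd))
      (Computable.snd.comp Computable.snd)
  refine Computable₂.mk (h.of_eq fun b => ?_)
  induction b.2 with
  | zero => simp
  | succ n ih =>
    simp only [Nat.count_succ, ih]
    cases p b.1 n <;> simp

theorem Primrec.nat_pow : Primrec₂ ((· ^ ·) : ℕ → ℕ → ℕ) :=
  Primrec₂.unpaired'.1 Nat.Primrec.pow

theorem Primrec.nat_coprime : PrimrecRel Nat.Coprime := by
  have hR : PrimrecRel fun (k : ℕ) (y : ℕ × ℕ) => ¬(y.1 % k = 0 ∧ y.2 % k = 0) ∨ k ≤ 1 := by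
    have h1 : PrimrecPred fun x : ℕ × (ℕ × ℕ) => x.2.1 % x.1 = 0 :=
      Primrec.eq.comp (Primrec.nat_mod.comp (Primrec.fst.comp Primrec.snd) Primrec.fst)
        (Primrec.const 0)
    have h2 : PrimrecPred fun x : ℕ × (ℕ × ℕ) => x.2.2 % x.1 = 0 :=
      Primrec.eq.comp (Primrec.nat_mod.comp (Primrec.snd.comp Primrec.snd) Primrec.fst)
        (Primrec.const 0)
    have h3 : PrimrecPred fun x : ℕ × (ℕ × ℕ) => x.1 ≤ 1 :=
      Primrec.nat_le.comp Primrec.fst (Primrec.const 1)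
    exact ((h1.and h2).not.or h3)
  have hc : PrimrecPred fun y : ℕ × ℕ =>
      ∀ k < y.1 + y.2 + 3, ¬(y.1 % k = 0 ∧ y.2 % k = 0) ∨ k ≤ 1 := by
    have : PrimrecRel fun (n : ℕ) (y : ℕ × ℕ) =>
        ∀ k < n, ¬(y.1 % k = 0 ∧ y.2 % k = 0) ∨ k ≤ 1 := by
      have := (PrimrecRel.forall_mem_list hR).comp
        (Primrec.list_range.comp Primrec.fst) (Primrec.snd (α := ℕ) (β := ℕ × ℕ))
      simpa only [List.mem_range] using this.primrecRel
    exact this.comp (Primrec.nat_add.comp (Primrec.nat_add.comp Primrec.fst Primrec.snd)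
      (Primrec.const 3)) Primrec.id
  refine hc.of_eq fun y => ?_
  constructor
  · intro h
    rcases Nat.eq_zero_or_pos (Nat.gcd y.1 y.2) with h0 | h0
    · obtain ⟨e1, e2⟩ := Nat.gcd_eq_zero_iff.1 h0
      have := h 2
      grind
    · have hle : Nat.gcd y.1 y.2 < y.1 + y.2 + 3 := by
        rcases Nat.eq_zero_or_pos y.1 with h1 | h1
        · rw [h1, Nat.gcd_zero_left]; omega
        · have := Nat.gcd_le_left y.2 h1
          omega
      rcases h _ hle with h | h
      · exact absurd ⟨Nat.mod_eq_zero_of_dvd (Nat.gcd_dvd_left _ _),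
          Nat.mod_eq_zero_of_dvd (Nat.gcd_dvd_right _ _)⟩ h
      · exact le_antisymm h h0
  · intro h k _
    by_contra hk
    push Not at hk
    have := Nat.dvd_gcd (Nat.dvd_of_mod_eq_zero hk.1.1) (Nat.dvd_of_mod_eq_zero hk.1.2)
    rw [h] at this
    have := Nat.le_of_dvd one_pos this
    omega

/-- The code of a rational number under `Rat.instEncodable`, which `Rat.instDenumerable`
then renumbers without gaps. -/
def ratCode (q : ℚ) : ℕ := @encode ℚ Rat.instEncodable q

def isRatCode (x : ℕ) : Bool :=
  decide (0 < x.unpair.2 ∧ Nat.Coprime ((x.unpair.1 + 1) / 2) x.unpair.2)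

theorem computable_isRatCode : Computable isRatCode := by
  have h1 : PrimrecPred fun x : ℕ => 0 < x.unpair.2 :=
    Primrec.nat_lt.comp (Primrec.const 0) (Primrec.snd.comp Primrec.unpair)
  have h2 : PrimrecPred fun x : ℕ => Nat.Coprime ((x.unpair.1 + 1) / 2) x.unpair.2 :=
    Primrec.nat_coprime.comp
      (Primrec.nat_div.comp (Primrec.succ.comp (Primrec.fst.comp Primrec.unpair))
        (Primrec.const 2))
      (Primrec.snd.comp Primrec.unpair)
  exact (h1.and h2).decide.to_comp

theorem encode_int (z : ℤ) : encode z = if 0 ≤ z then 2 * z.natAbs else 2 * z.natAbs - 1 := by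
  cases z with
  | ofNat n => simp; rfl
  | negSucc n => rw [if_neg (by simp)]; rfl

theorem ratCode_eq (q : ℚ) : ratCode q =
    Nat.pair (if 0 ≤ q.num then 2 * q.num.natAbs else 2 * q.num.natAbs - 1) q.den := by
  rw [← encode_int]; rfl

theorem isRatCode_iff (x : ℕ) : isRatCode x = true ↔ x ∈ Set.range ratCode := by
  constructor
  · intro h
    obtain ⟨h1, h2⟩ : 0 < x.unpair.2 ∧ Nat.Coprime ((x.unpair.1 + 1) / 2) x.unpair.2 := by
      simpa [isRatCode] using h
    rcases Nat.even_or_odd' x.unpair.1 with ⟨a, ha | ha⟩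
    · have ha' : (x.unpair.1 + 1) / 2 = a := by omega
      rw [ha'] at h2
      refine ⟨⟨a, x.unpair.2, h1.ne', by simpa using h2⟩, ?_⟩
      rw [ratCode_eq]
      simp [← ha]
    · have ha' : (x.unpair.1 + 1) / 2 = a + 1 := by omega
      rw [ha'] at h2
      refine ⟨⟨Int.negSucc a, x.unpair.2, h1.ne', by simpa using h2⟩, ?_⟩
      rw [ratCode_eq, if_neg (by simp)]
      have : 2 * (a + 1) - 1 = x.unpair.1 := by omega
      simp [this]
  · rintro ⟨q, rfl⟩
    have h := q.reduced
    have hd := q.den_pos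
    rw [isRatCode, ratCode_eq]
    simp only [Nat.unpair_pair, decide_eq_true_eq]
    refine ⟨hd, ?_⟩
    convert h using 1
    split_ifs with h0
    · omega
    · have : q.num.natAbs ≠ 0 := by omega
      omega

theorem encode_rat (q : ℚ) :
    @encode ℚ Primcodable.toEncodable q = Nat.count (fun x => isRatCode x = true) (ratCode q) := by
  have h1 : ∀ p : DecidablePred (· ∈ Set.range ratCode),
      @encode ℚ Primcodable.toEncodable q = @Nat.count (· ∈ Set.range ratCode) p (ratCode q) := by
    intro p
    have : p = @decidableRangeEncode ℚ Rat.instEncodable := by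
      funext x; exact Subsingleton.elim _ _
    rw [this]
    rfl
  rw [h1 fun x => decidable_of_iff _ (isRatCode_iff x), Nat.count_eq_card_filter_range,
    Nat.count_eq_card_filter_range]
  congr 1
  ext x
  simp [isRatCode_iff]

theorem computable_ratCount : Computable fun n => Nat.count (fun x => isRatCode x = true) n :=
  (Computable.nat_count (α := Unit) (p := fun _ => isRatCode)
    (computable_isRatCode.comp Computable.snd)).comp (Computable.const ()) Computable.id

theorem computable_ratCode : Computable ratCode := by
  have hp : Computable₂ fun (q : ℚ) (x : ℕ) => isRatCode x &&
      decide (Nat.count (fun x => isRatCode x = true) x =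
        @encode ℚ Primcodable.toEncodable q) := by
    refine Primrec.and.to_comp.comp (computable_isRatCode.comp Computable.snd) ?_
    exact Primrec.eq.decide.to_comp.comp (computable_ratCount.comp Computable.snd)
      (Computable.encode.comp Computable.fst)
  refine Computable.of_graph hp fun q x => ?_
  simp only [Bool.and_eq_true, decide_eq_true_eq, encode_rat]
  constructor
  · rintro ⟨h1, h2⟩
    exact Nat.count_injective h1 ((isRatCode_iff _).2 ⟨q, rfl⟩) h2
  · rintro rfl
    exact ⟨(isRatCode_iff _).2 ⟨q, rfl⟩, rfl⟩

theorem computable_dyadic : Computable fun x : ℕ × ℕ => (x.1 : ℚ) / 2 ^ x.2 := by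
  have hp : Computable₂ fun (y : ℕ × ℕ) (x : ℕ) => isRatCode x &&
      decide (x.unpair.1 % 2 = 0 ∧ x.unpair.1 * 2 ^ y.2 = 2 * (y.1 * x.unpair.2)) := by
    refine Primrec.and.to_comp.comp (computable_isRatCode.comp Computable.snd) ?_
    refine (PrimrecPred.and (Primrec.eq.comp ?_ (Primrec.const 0))
      (Primrec.eq.comp ?_ ?_)).decide.to_comp
    · exact Primrec.nat_mod.comp (Primrec.fst.comp (Primrec.unpair.comp Primrec.snd))
        (Primrec.const 2)
    · exact Primrec.nat_mul.comp (Primrec.fst.comp (Primrec.unpair.comp Primrec.snd))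
        (Primrec.nat_pow.comp (Primrec.const 2) (Primrec.snd.comp Primrec.fst))
    · exact Primrec.nat_mul.comp (Primrec.const 2)
        (Primrec.nat_mul.comp (Primrec.fst.comp Primrec.fst)
          (Primrec.snd.comp (Primrec.unpair.comp Primrec.snd)))
  have hc : Computable fun x : ℕ × ℕ => ratCode ((x.1 : ℚ) / 2 ^ x.2) := by
    have key : ∀ (y : ℕ × ℕ) (q : ℚ), ((ratCode q).unpair.1 % 2 = 0 ∧
        (ratCode q).unpair.1 * 2 ^ y.2 = 2 * (y.1 * (ratCode q).unpair.2)) ↔ q = (y.1 : ℚ) / 2 ^ y.2 := by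
      intro y q
      rw [eq_div_iff (by positivity), ratCode_eq]
      simp only [Nat.unpair_pair]
      have hd : (q.den : ℚ) ≠ 0 := by exact_mod_cast q.den_pos.ne'
      have e : q * 2 ^ y.2 = y.1 ↔ q.num * 2 ^ y.2 = (y.1 : ℤ) * q.den := by
        nth_rewrite 1 [← Rat.num_div_den q]
        rw [div_mul_eq_mul_div, div_eq_iff hd]
        exact_mod_cast Iff.rfl
      rw [e]
      split_ifs with h0
      · obtain ⟨n, hn⟩ := Int.eq_ofNat_of_zero_le h0
        rw [hn]
        simp only [Int.natAbs_natCast, mul_assoc, mul_right_inj' two_ne_zero, Nat.mul_mod_right,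
          true_and]
        exact_mod_cast Iff.rfl
      · constructor
        · rintro ⟨h, -⟩
          omega
        · intro h
          have h1 : q.num * 2 ^ y.2 < 0 := mul_neg_of_neg_of_pos (by omega) (by positivity)
          have h2 : 0 ≤ (y.1 : ℤ) * q.den := by positivity
          omega
    refine Computable.of_graph hp fun y x => ?_
    simp only [Bool.and_eq_true, decide_eq_true_eq]
    constructor
    · rintro ⟨h1, h2⟩
      obtain ⟨q, rfl⟩ := (isRatCode_iff x).1 h1
      rw [(key y q).1 h2]
    · rintro rfl
      exact ⟨(isRatCode_iff _).2 ⟨_, rfl⟩, (key y _).2 rfl⟩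
  exact Computable.encode_iff.1 ((computable_ratCount.comp hc).of_eq fun x => (encode_rat _).symm)

theorem computable_natCast_lt_mul :
    Computable fun x : (ℕ × ℕ) × ℚ => decide ((x.1.1 : ℚ) < x.1.2 * x.2) := by
  have hp : Primrec fun x : (ℕ × ℕ) × ℕ => decide (x.2.unpair.1 % 2 = 0 ∧
      2 * x.1.1 * x.2.unpair.2 < x.1.2 * x.2.unpair.1) := by
    have h1 : PrimrecPred fun x : (ℕ × ℕ) × ℕ => x.2.unpair.1 % 2 = 0 :=
      Primrec.eq.comp (Primrec.nat_mod.comp (Primrec.fst.comp (Primrec.unpair.comp Primrec.snd))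
        (Primrec.const 2)) (Primrec.const 0)
    have h2 : PrimrecPred fun x : (ℕ × ℕ) × ℕ =>
        2 * x.1.1 * x.2.unpair.2 < x.1.2 * x.2.unpair.1 :=
      Primrec.nat_lt.comp
        (Primrec.nat_mul.comp (Primrec.nat_mul.comp (Primrec.const 2)
          (Primrec.fst.comp Primrec.fst)) (Primrec.snd.comp (Primrec.unpair.comp Primrec.snd)))
        (Primrec.nat_mul.comp (Primrec.snd.comp Primrec.fst)
          (Primrec.fst.comp (Primrec.unpair.comp Primrec.snd)))
    exact (h1.and h2).decide
  refine (hp.to_comp.comp (Computable.fst.pair (computable_ratCode.comp Computable.snd))).of_eq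
    fun x => ?_
  obtain ⟨⟨a, b⟩, q⟩ := x
  simp only [ratCode_eq, Nat.unpair_pair, decide_eq_decide]
  have hd : (0 : ℚ) < q.den := by exact_mod_cast q.den_pos
  have e : (a : ℚ) < b * q ↔ (a : ℤ) * q.den < b * q.num := by
    nth_rewrite 1 [← Rat.num_div_den q]
    rw [← mul_div_assoc, lt_div_iff₀ hd]
    exact_mod_cast Iff.rfl
  rw [e]
  split_ifs with h0
  · obtain ⟨n, hn⟩ := Int.eq_ofNat_of_zero_le h0
    rw [hn]
    have : 2 * a * q.den < b * (2 * n) ↔ a * q.den < b * n := by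
      constructor <;> intro h <;> nlinarith
    simp only [Int.natAbs_natCast, this, Nat.mul_mod_right, true_and]
    exact_mod_cast Iff.rfl
  · constructor
    · rintro ⟨h, -⟩
      omega
    · intro h
      have h1 : (b : ℤ) * q.num ≤ 0 := mul_nonpos_of_nonneg_of_nonpos (by positivity) (by omega)
      have h2 : 0 ≤ (a : ℤ) * q.den := by positivity
      omega

/-- The dyadic rational `u / 2 ^ v` stored in the first two components of an iterated pair. -/
def dyadicOf (x : ℕ) : ℚ := (x.unpair.1 : ℚ) / 2 ^ x.unpair.2.unpair.1

theorem computable_dyadicOf : Computable dyadicOf :=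
  (computable_dyadic.comp (g := fun x : ℕ => (x.unpair.1, x.unpair.2.unpair.1))
    ((Primrec.fst.comp Primrec.unpair).pair (Primrec.fst.comp (Primrec.unpair.comp
      (Primrec.snd.comp Primrec.unpair)))).to_comp).of_eq fun _ => rfl

theorem computable_dyadicOf_lt : Computable₂ fun x y => decide (dyadicOf x < dyadicOf y) := by
  have hp : Primrec₂ fun x y : ℕ => decide (x.unpair.1 * 2 ^ y.unpair.2.unpair.1 <
      y.unpair.1 * 2 ^ x.unpair.2.unpair.1) := by
    have hu : Primrec fun x : ℕ => x.unpair.1 := Primrec.fst.comp Primrec.unpair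
    have hv : Primrec fun x : ℕ => 2 ^ x.unpair.2.unpair.1 :=
      Primrec.nat_pow.comp (Primrec.const 2)
        (Primrec.fst.comp (Primrec.unpair.comp (Primrec.snd.comp Primrec.unpair)))
    exact (Primrec.nat_lt.comp
      (Primrec.nat_mul.comp (hu.comp Primrec.fst) (hv.comp Primrec.snd))
      (Primrec.nat_mul.comp (hu.comp Primrec.snd) (hv.comp Primrec.fst))).decide
  refine Computable.of_eq hp.to_comp fun x => ?_
  rw [decide_eq_decide, dyadicOf, dyadicOf, div_lt_div_iff₀ (by positivity) (by positivity)]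
  exact_mod_cast Iff.rfl

/-- The largest dyadic rational certified by `R` at a stage below `k`, as an index. -/
def bestCertified (R : ℕ → Bool) (k : ℕ) : ℕ :=
  Nat.rec 0 (fun x b => bif R x && decide (dyadicOf b < dyadicOf x) then x else b) k

theorem bestCertified_succ (R : ℕ → Bool) (k : ℕ) : bestCertified R (k + 1) =
    bif R k && decide (dyadicOf (bestCertified R k) < dyadicOf k) then k
    else bestCertified R k := rfl

theorem dyadicOf_bestCertified_le (R : ℕ → Bool) (k : ℕ) :
    dyadicOf (bestCertified R k) ≤ dyadicOf (bestCertified R (k + 1)) := by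
  rw [bestCertified_succ]
  cases h : (R k && decide (dyadicOf (bestCertified R k) < dyadicOf k)) with
  | false => simp
  | true =>
    simp only [Bool.and_eq_true, decide_eq_true_eq] at h
    exact h.2.le

theorem le_dyadicOf_bestCertified {R : ℕ → Bool} {x : ℕ} (hx : R x = true) :
    dyadicOf x ≤ dyadicOf (bestCertified R (x + 1)) := by
  rw [bestCertified_succ]
  cases h : (R x && decide (dyadicOf (bestCertified R x) < dyadicOf x)) with
  | false => simpa [hx] using h
  | true => simp

theorem dyadicOf_bestCertified (R : ℕ → Bool) (k : ℕ) :
    dyadicOf (bestCertified R k) = 0 ∨ R (bestCertified R k) = true := by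
  induction k with
  | zero => left; simp [bestCertified, dyadicOf]
  | succ k ih =>
    rw [bestCertified_succ]
    cases h : (R k && decide (dyadicOf (bestCertified R k) < dyadicOf k)) with
    | false => simpa using ih
    | true =>
      simp only [Bool.and_eq_true] at h
      exact Or.inr h.1

theorem computable_bestCertified {R : List Bool → ℕ → Bool} (hR : Computable₂ R) :
    Computable fun x : List Bool × ℕ => bestCertified (R x.1) x.2 := by
  refine Computable.nat_rec (f := Prod.snd) (g := fun _ : List Bool × ℕ => 0)
    (h := fun a b => bif R a.1 b.1 && decide (dyadicOf b.2 < dyadicOf b.1) then b.1 else b.2)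
    Computable.snd (Computable.const 0) (Computable₂.mk ?_)
  refine Computable.cond (c := fun c : (List Bool × ℕ) × ℕ × ℕ =>
    R c.1.1 c.2.1 && decide (dyadicOf c.2.2 < dyadicOf c.2.1)) ?_
    (Computable.fst.comp Computable.snd) (Computable.snd.comp Computable.snd)
  exact Primrec.and.to_comp.comp
    (hR.comp (Computable.fst.comp Computable.fst) (Computable.fst.comp Computable.snd))
    (computable_dyadicOf_lt.comp (Computable.snd.comp Computable.snd)
      (Computable.fst.comp Computable.snd))

/-- A positive function is constructive as soon as a computable relation certifies
dyadic lower bounds that are strict and arbitrarily good. -/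
theorem Constructive.of_certificates {g : List Bool → ℝ} (hg : ∀ w, 0 < g w)
    {R : List Bool → ℕ → Bool} (hR : Computable₂ R)
    (sound : ∀ w x, R w x = true → (dyadicOf x : ℝ) < g w)
    (complete : ∀ w y, 0 ≤ y → y < g w → ∃ x, R w x = true ∧ y < dyadicOf x) :
    Constructive g := by
  have hlt : ∀ w n, (dyadicOf (bestCertified (R w) n) : ℝ) < g w := fun w n => by
    rcases dyadicOf_bestCertified (R w) n with h | h
    · rw [h]; simpa using hg w
    · exact sound _ _ h
  refine ⟨fun x => dyadicOf (bestCertified (R x.1) x.2),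
    computable_dyadicOf.comp (computable_bestCertified hR),
    fun w n => ⟨dyadicOf_bestCertified_le _ _, hlt w n⟩, fun w => ?_⟩
  refine (IsLUB.ciSup_eq ⟨?_, fun b hb => ?_⟩).symm
  · rintro _ ⟨n, rfl⟩
    exact (hlt w n).le
  · by_contra! hbg
    have hb' : ∀ n, (dyadicOf (bestCertified (R w) n) : ℝ) ≤ b := fun n => hb ⟨n, rfl⟩
    have h0 : 0 ≤ b := by simpa [bestCertified, dyadicOf] using hb' 0
    obtain ⟨x, hx, hxb⟩ := complete w b h0 hbg
    have : (dyadicOf x : ℝ) ≤ dyadicOf (bestCertified (R w) (x + 1)) := by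
      exact_mod_cast le_dyadicOf_bestCertified hx
    linarith [hb' (x + 1)]

theorem preSeq_succ (S : ℕ → Bool) (n : ℕ) : preSeq S (n + 1) = preSeq S n ++ [S n] := by
  simp [preSeq, List.range_succ]

theorem length_preSeq (S : ℕ → Bool) (n : ℕ) : (preSeq S n).length = n := by
  simp [preSeq]

/-- Pad a binary string with zeros to an infinite sequence. -/
def padZero (v : List Bool) (i : ℕ) : Bool := v.getD i false

theorem preSeq_padZero (v : List Bool) : preSeq (padZero v) v.length = v := by
  refine List.ext_getElem (by simp [preSeq]) fun i h1 h2 => ?_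
  simp [preSeq, padZero, h2]

/-- The output after `k` steps of the program coded by `j.unpair.1` on input `j.unpair.2`. -/
def progOut (k j : ℕ) : Option (List Bool) :=
  (Nat.Partrec.Code.evaln k (Denumerable.ofNat Nat.Partrec.Code j.unpair.1) j.unpair.2).bind decode

theorem progOut_mono {k k' j : ℕ} (h : k ≤ k') {v : List Bool} (hv : progOut k j = some v) :
    progOut k' j = some v := by
  rw [progOut, Option.bind_eq_some_iff] at hv ⊢
  obtain ⟨x, hx, hv⟩ := hv
  exact ⟨x, Nat.Partrec.Code.evaln_mono h hx, hv⟩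

/-- The program-input pair `j = ⟨c, n, i⟩` is admitted when `i < 2 ^ (a * n / q + 1)`; at stage `k`
it charges the prefixes of its zero-padded output. -/
def charges (a q k j : ℕ) (w : List Bool) : Bool :=
  decide (j.unpair.2.unpair.2 < 2 ^ (a * j.unpair.2.unpair.1 / q + 1)) &&
    decide ((progOut k j).map (fun v => preSeq (padZero v) w.length) = some w)

/-- The negative logarithm of the mass that `j = ⟨c, n, i⟩` contributes. -/
def chargeExp (a q j : ℕ) : ℕ :=
  j.unpair.1 + a * j.unpair.2.unpair.1 / q + j.unpair.2.unpair.1 / q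

theorem charges_mono {a q k k' j : ℕ} (h : k ≤ k') {w : List Bool}
    (hc : charges a q k j w = true) : charges a q k' j w = true := by
  simp only [charges, Bool.and_eq_true, decide_eq_true_eq, Option.map_eq_some_iff] at hc ⊢
  obtain ⟨h1, v, hv, hw⟩ := hc
  exact ⟨h1, v, progOut_mono h hv, hw⟩

noncomputable def charge (a q k j : ℕ) (w : List Bool) : ℝ :=
  if charges a q k j w = true then (1 / 2) ^ chargeExp a q j else 0

theorem charge_nonneg (a q k j : ℕ) (w : List Bool) : 0 ≤ charge a q k j w := by
  unfold charge; split_ifs <;> positivity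

theorem charge_mono {a q k k' j : ℕ} (h : k ≤ k') (w : List Bool) :
    charge a q k j w ≤ charge a q k' j w := by
  unfold charge
  split_ifs with h1 h2 h2
  · rfl
  · exact absurd (charges_mono h h1) h2
  · positivity
  · rfl

theorem charge_add (a q k j : ℕ) (w : List Bool) :
    charge a q k j w = charge a q k j (w ++ [false]) + charge a q k j (w ++ [true]) := by
  simp only [charge, charges]
  rcases Option.eq_none_or_eq_some (progOut k j) with hv | ⟨v, hv⟩
  · simp [hv]
  · simp only [hv, List.length_append, List.length_singleton, preSeq_succ, Option.map_some,
      Option.some.injEq]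
    by_cases hw : preSeq (padZero v) w.length = w
    · rw [hw]
      cases padZero v w.length <;> simp
    · have hb : ∀ b, preSeq (padZero v) w.length ++ [padZero v w.length] ≠ w ++ [b] :=
        fun b hb => hw (List.append_inj_left' hb rfl)
      simp [hw, hb]

/-- The total mass at stage `k` of the cylinder of `w`, including a copy of Lebesgue measure. -/
noncomputable def stageMass (a q k : ℕ) (w : List Bool) : ℝ :=
  (1 / 2) ^ w.length + ∑ j ∈ Finset.range k, charge a q k j w

theorem stageMass_pos (a q k : ℕ) (w : List Bool) : 0 < stageMass a q k w :=
  add_pos_of_pos_of_nonneg (by positivity) (Finset.sum_nonneg fun _ _ => charge_nonneg ..)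

theorem stageMass_mono (a q : ℕ) (w : List Bool) : Monotone fun k => stageMass a q k w := by
  intro k k' h
  have := Finset.sum_le_sum_of_subset_of_nonneg (f := fun j => charge a q k' j w)
    (Finset.range_subset_range.2 h) fun _ _ _ => charge_nonneg ..
  have := Finset.sum_le_sum (s := Finset.range k) fun j _ =>
    charge_mono (a := a) (q := q) h (j := j) w
  simp only [stageMass]
  linarith

theorem stageMass_add (a q k : ℕ) (w : List Bool) :
    stageMass a q k w = stageMass a q k (w ++ [false]) + stageMass a q k (w ++ [true]) := by
  simp only [stageMass, Finset.sum_congr rfl fun j _ => charge_add a q k j w,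
    Finset.sum_add_distrib, List.length_append, List.length_singleton, pow_succ]
  ring

theorem summable_half_pow_div {q : ℕ} (hq : 0 < q) :
    Summable fun n : ℕ => (1 / 2 : ℝ) ^ (n / q) := by
  have hq' : (0 : ℝ) < q := by exact_mod_cast hq
  have hz : (2 : ℝ) ^ (-(1 / q : ℝ)) < 1 :=
    Real.rpow_lt_one_of_one_lt_of_neg one_lt_two (by simpa using hq)
  refine Summable.of_nonneg_of_le (fun n => by positivity) (fun n => ?_)
    ((summable_geometric_of_lt_one (by positivity) hz).mul_left 2)
  have hn : (n : ℝ) / q ≤ (n / q : ℕ) + 1 := by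
    rw [div_le_iff₀ hq']
    exact_mod_cast (Nat.lt_mul_of_div_lt (Nat.lt_succ_self _) hq).le
  calc (1 / 2 : ℝ) ^ (n / q) = 2 ^ (-((n / q : ℕ) : ℝ)) := by
        rw [Real.rpow_neg zero_le_two, Real.rpow_natCast, one_div, inv_pow]
    _ ≤ 2 ^ (1 + -(1 / q : ℝ) * n) :=
        Real.rpow_le_rpow_of_exponent_le one_le_two (by
          have : -(1 / q : ℝ) * n = -(n / q) := by ring
          linarith)
    _ = 2 * (2 ^ (-(1 / q : ℝ))) ^ n := by
        rw [Real.rpow_add two_pos, Real.rpow_one, Real.rpow_mul zero_le_two, Real.rpow_natCast]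

/-- An upper bound for all contributions of `j`, regardless of outputs. -/
noncomputable def chargeBound (a q j : ℕ) : ℝ :=
  if j.unpair.2.unpair.2 < 2 ^ (a * j.unpair.2.unpair.1 / q + 1) then
    (1 / 2) ^ chargeExp a q j else 0

theorem summable_chargeBound (a : ℕ) {q : ℕ} (hq : 0 < q) : Summable (chargeBound a q) := by
  let V : ℕ × ℕ → ℝ := fun y => if y.2 < 2 ^ (a * y.1 / q + 1) then
    (1 / 2) ^ (a * y.1 / q + y.1 / q) else 0
  have hV0 : ∀ y, 0 ≤ V y := fun y => by
    simp only [V]; split_ifs <;> positivity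
  have hrow : ∀ n, HasSum (fun i => V (n, i)) (2 * (1 / 2) ^ (n / q)) := by
    intro n
    have h := hasSum_sum_of_ne_finset_zero (L := SummationFilter.unconditional ℕ)
      (f := fun i => V (n, i))
      (s := Finset.range (2 ^ (a * n / q + 1))) (by
        intro i hi
        have : ¬ i < 2 ^ (a * n / q + 1) := by simpa using hi
        simp [V, this])
    convert h using 1
    rw [Finset.sum_congr rfl (g := fun _ => (1 / 2 : ℝ) ^ (a * n / q + n / q))]
    · simp only [Finset.sum_const, Finset.card_range, nsmul_eq_mul, pow_add, pow_one]
      push_cast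
      have : (2 : ℝ) ^ (a * n / q) * (1 / 2) ^ (a * n / q) = 1 := by
        rw [← mul_pow]; norm_num
      linear_combination (-2 * (1 / 2 : ℝ) ^ (n / q)) * this
    · intro i hi
      have : i < 2 ^ (a * n / q + 1) := by simpa using hi
      simp [V, this]
  have hV : Summable V := by
    rw [summable_prod_of_nonneg hV0]
    refine ⟨fun n => (hrow n).summable, ?_⟩
    simp only [(hrow _).tsum_eq]
    exact (summable_half_pow_div hq).mul_left 2
  have hV' : Summable fun m : ℕ => V m.unpair :=
    (Nat.pairEquiv.symm.summable_iff (f := V)).2 hV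
  have hc : Summable fun c : ℕ => (1 / 2 : ℝ) ^ c := summable_geometric_two
  have h := hc.mul_of_nonneg hV' (fun c => by positivity) (fun m => hV0 _)
  have h' := (Nat.pairEquiv.symm.summable_iff (f := fun x : ℕ × ℕ =>
    (1 / 2 : ℝ) ^ x.1 * V x.2.unpair)).2 h
  refine h'.congr fun j => ?_
  simp only [Function.comp, Nat.pairEquiv_symm_apply, V, chargeBound, chargeExp]
  split_ifs
  · ring
  · simp

theorem charge_le_chargeBound (a q k j : ℕ) (w : List Bool) :
    charge a q k j w ≤ chargeBound a q j := by
  unfold charge chargeBound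
  split_ifs with h1 h2 h2
  · rfl
  · simp only [charges, Bool.and_eq_true, decide_eq_true_eq] at h1
    exact absurd h1.1 h2
  · positivity
  · rfl

theorem bddAbove_stageMass (a : ℕ) {q : ℕ} (hq : 0 < q) (w : List Bool) :
    BddAbove (Set.range fun k => stageMass a q k w) := by
  refine ⟨(1 / 2) ^ w.length + ∑' j, chargeBound a q j, ?_⟩
  rintro _ ⟨k, rfl⟩
  have h0 : ∀ j, 0 ≤ chargeBound a q j := fun j =>
    (charge_nonneg a q 0 j []).trans (charge_le_chargeBound ..)
  have h1 := (summable_chargeBound a hq).sum_le_tsum (Finset.range k) fun j _ => h0 j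
  have h2 := Finset.sum_le_sum (s := Finset.range k) fun j _ => charge_le_chargeBound a q k j w
  simp only [stageMass]
  linarith

noncomputable def limitMass (a q : ℕ) (w : List Bool) : ℝ := ⨆ k, stageMass a q k w

theorem tendsto_stageMass (a : ℕ) {q : ℕ} (hq : 0 < q) (w : List Bool) :
    Tendsto (fun k => stageMass a q k w) atTop (nhds (limitMass a q w)) :=
  tendsto_atTop_ciSup (stageMass_mono a q w) (bddAbove_stageMass a hq w)

theorem stageMass_le_limitMass (a : ℕ) {q : ℕ} (hq : 0 < q) (k : ℕ) (w : List Bool) :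
    stageMass a q k w ≤ limitMass a q w :=
  le_ciSup (bddAbove_stageMass a hq w) k

theorem limitMass_add (a : ℕ) {q : ℕ} (hq : 0 < q) (w : List Bool) :
    limitMass a q w = limitMass a q (w ++ [false]) + limitMass a q (w ++ [true]) := by
  refine tendsto_nhds_unique (tendsto_stageMass a hq w) ?_
  simp only [stageMass_add a q _ w]
  exact (tendsto_stageMass a hq _).add (tendsto_stageMass a hq _)

/-- The `t`-gale induced by the limit mass. -/
noncomputable def massGale (t : ℝ) (a q : ℕ) (w : List Bool) : ℝ :=
  2 ^ (t * w.length) * limitMass a q w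

theorem massGale_pos (t : ℝ) (a : ℕ) {q : ℕ} (hq : 0 < q) (w : List Bool) :
    0 < massGale t a q w :=
  mul_pos (by positivity) ((stageMass_pos a q 0 w).trans_le (stageMass_le_limitMass a hq 0 w))

theorem gale_massGale (t : ℝ) (a : ℕ) {q : ℕ} (hq : 0 < q) : Gale t (massGale t a q) := by
  refine ⟨fun w => (massGale_pos t a hq w).le, fun w => ?_⟩
  simp only [massGale, limitMass_add a hq w, List.length_append, List.length_singleton,
    Nat.cast_add, Nat.cast_one, mul_add, mul_one, Real.rpow_add two_pos]
  have : (0 : ℝ) < 2 ^ t := by positivity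
  field_simp

theorem primrec_preSeq_padZero : Primrec₂ fun (v : List Bool) (n : ℕ) => preSeq (padZero v) n :=
  Primrec.list_map (Primrec.list_range.comp Primrec.snd)
    ((Primrec.list_getD false).comp (Primrec.fst.comp Primrec.fst) Primrec.snd)

theorem primrec_progOut : Primrec₂ progOut := by
  refine Primrec.option_bind (f := fun x : ℕ × ℕ => Nat.Partrec.Code.evaln x.1
    (Denumerable.ofNat Nat.Partrec.Code x.2.unpair.1) x.2.unpair.2)
    (g := fun _ y => decode y) ?_ (Primrec.decode.comp Primrec.snd)
  exact Nat.Partrec.Code.primrec_evaln.comp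
    ((Primrec.fst.pair ((Primrec.ofNat _).comp
      (Primrec.fst.comp (Primrec.unpair.comp Primrec.snd)))).pair
      (Primrec.snd.comp (Primrec.unpair.comp Primrec.snd)))

theorem primrec_charges (a q : ℕ) :
    Primrec fun x : (ℕ × ℕ) × List Bool => charges a q x.1.1 x.1.2 x.2 := by
  have hj : Primrec fun x : (ℕ × ℕ) × List Bool => x.1.2.unpair.2.unpair :=
    Primrec.unpair.comp (Primrec.snd.comp (Primrec.unpair.comp (Primrec.snd.comp Primrec.fst)))
  have h1 : PrimrecPred fun x : (ℕ × ℕ) × List Bool =>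
      x.1.2.unpair.2.unpair.2 < 2 ^ (a * x.1.2.unpair.2.unpair.1 / q + 1) :=
    Primrec.nat_lt.comp (Primrec.snd.comp hj) (Primrec.nat_pow.comp (Primrec.const 2)
      (Primrec.succ.comp (Primrec.nat_div.comp
        (Primrec.nat_mul.comp (Primrec.const a) (Primrec.fst.comp hj)) (Primrec.const q))))
  have h2 : PrimrecPred fun x : (ℕ × ℕ) × List Bool =>
      (progOut x.1.1 x.1.2).map (fun v => preSeq (padZero v) x.2.length) = some x.2 := by
    refine Primrec.eq.comp ?_ (Primrec.option_some.comp Primrec.snd)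
    exact Primrec.option_map
      (primrec_progOut.comp (Primrec.fst.comp Primrec.fst) (Primrec.snd.comp Primrec.fst))
      (primrec_preSeq_padZero.comp Primrec.snd
        (Primrec.list_length.comp (Primrec.snd.comp Primrec.fst)))
  exact Primrec.and.comp h1.decide h2.decide

theorem primrec_chargeExp (a q : ℕ) : Primrec (chargeExp a q) := by
  have hn : Primrec fun j : ℕ => j.unpair.2.unpair.1 :=
    Primrec.fst.comp (Primrec.unpair.comp (Primrec.snd.comp Primrec.unpair))
  exact Primrec.nat_add.comp (Primrec.nat_add.comp (Primrec.fst.comp Primrec.unpair)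
    (Primrec.nat_div.comp (Primrec.nat_mul.comp (Primrec.const a) hn) (Primrec.const q)))
    (Primrec.nat_div.comp hn (Primrec.const q))

/-- Add the contribution of `j` to a fraction with numerator `s.1` and denominator `2 ^ s.2`. -/
def stageStep (a q k : ℕ) (w : List Bool) (j : ℕ) (s : ℕ × ℕ) : ℕ × ℕ :=
  bif charges a q k j w
    then (s.1 * 2 ^ chargeExp a q j + 2 ^ s.2, s.2 + chargeExp a q j) else s

/-- Numerator and binary exponent of the denominator of the first `m` terms of
`stageMass a q k w`. -/
def stageFraction (a q k : ℕ) (w : List Bool) (m : ℕ) : ℕ × ℕ :=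
  Nat.rec (1, w.length) (stageStep a q k w) m

theorem stageFraction_eq (a q k : ℕ) (w : List Bool) (m : ℕ) :
    ((stageFraction a q k w m).1 : ℝ) / 2 ^ (stageFraction a q k w m).2 =
      (1 / 2) ^ w.length + ∑ j ∈ Finset.range m, charge a q k j w := by
  induction m with
  | zero => simp [stageFraction]
  | succ m ih =>
    rw [Finset.sum_range_succ, ← add_assoc, ← ih]
    have hs : stageFraction a q k w (m + 1) = stageStep a q k w m (stageFraction a q k w m) := rfl
    rw [hs, stageStep, charge]
    cases charges a q k m w with
    | false => simp
    | true =>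
      simp only [cond_true, if_true, pow_add, one_div, inv_pow]
      push_cast
      field_simp

theorem primrec_stageStep (a q : ℕ) : Primrec₂ fun (x : ℕ × List Bool) (y : ℕ × ℕ × ℕ) =>
    stageStep a q x.1 x.2 y.1 y.2 := by
  have hj : Primrec fun z : (ℕ × List Bool) × ℕ × ℕ × ℕ => z.2.1 := Primrec.fst.comp Primrec.snd
  have hs : Primrec fun z : (ℕ × List Bool) × ℕ × ℕ × ℕ => z.2.2 := Primrec.snd.comp Primrec.snd
  have he : Primrec fun z : (ℕ × List Bool) × ℕ × ℕ × ℕ => chargeExp a q z.2.1 :=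
    (primrec_chargeExp a q).comp hj
  have hc : Primrec fun z : (ℕ × List Bool) × ℕ × ℕ × ℕ => charges a q z.1.1 z.2.1 z.1.2 :=
    (primrec_charges a q).comp (g := fun z : (ℕ × List Bool) × ℕ × ℕ × ℕ =>
      ((z.1.1, z.2.1), z.1.2)) (((Primrec.fst.comp Primrec.fst).pair hj).pair
      (Primrec.snd.comp Primrec.fst))
  have hn : Primrec fun z : (ℕ × List Bool) × ℕ × ℕ × ℕ =>
      z.2.2.1 * 2 ^ chargeExp a q z.2.1 + 2 ^ z.2.2.2 :=
    Primrec.nat_add.comp (Primrec.nat_mul.comp (Primrec.fst.comp hs)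
      (Primrec.nat_pow.comp (Primrec.const 2) he))
      (Primrec.nat_pow.comp (Primrec.const 2) (Primrec.snd.comp hs))
  have hd : Primrec fun z : (ℕ × List Bool) × ℕ × ℕ × ℕ => z.2.2.2 + chargeExp a q z.2.1 :=
    Primrec.nat_add.comp (Primrec.snd.comp hs) he
  exact (Primrec.cond hc (hn.pair hd) hs).of_eq fun _ => rfl

theorem primrec_stageFraction (a q : ℕ) :
    Primrec fun x : ℕ × List Bool => stageFraction a q x.1 x.2 x.1 :=
  (Primrec.nat_rec' (f := Prod.fst) (g := fun x : ℕ × List Bool => (1, x.2.length))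
    (h := fun x y => stageStep a q x.1 x.2 y.1 y.2) Primrec.fst
    ((Primrec.const 1).pair (Primrec.list_length.comp Primrec.snd))
    (primrec_stageStep a q)).of_eq fun _ => rfl

/-- The parameters `(k, T, B, s)` stored in the remaining components of a certificate. -/
def certParams (x : ℕ) : ℕ × ℕ × ℕ × ℕ :=
  let y := x.unpair.2.unpair.2
  (y.unpair.1, y.unpair.2.unpair.1, y.unpair.2.unpair.2.unpair.1, y.unpair.2.unpair.2.unpair.2)

theorem primrec_certParams : Primrec certParams := by
  have hf : Primrec fun x : ℕ => x.unpair.1 := Primrec.fst.comp Primrec.unpair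
  have hs : Primrec fun x : ℕ => x.unpair.2 := Primrec.snd.comp Primrec.unpair
  have hy : Primrec fun x : ℕ => x.unpair.2.unpair.2 := hs.comp hs
  exact (hf.comp hy).pair ((hf.comp (hs.comp hy)).pair
    ((hf.comp (hs.comp (hs.comp hy))).pair (hs.comp (hs.comp (hs.comp hy)))))

/-- `f` certifies at precision `s` that `T / B` is less than the real it approximates. -/
def certExponent (f : ℕ → ℚ) (T B s : ℕ) : Bool :=
  decide (((T * 2 ^ s + B : ℕ) : ℚ) < (B * 2 ^ s : ℕ) * f s)

/-- `u / 2 ^ v < 2 ^ (T * n / B) * M / 2 ^ E`, cleared of denominators and roots. -/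
def certValue (u v n T B M E : ℕ) : Bool :=
  decide ((u * 2 ^ E) ^ B < 2 ^ (T * n) * (M * 2 ^ v) ^ B)

/-- `x` certifies that `dyadicOf x` is less than the mass gale at `w`. -/
def galeCert (f : ℕ → ℚ) (a q : ℕ) (w : List Bool) (x : ℕ) : Bool :=
  certExponent f (certParams x).2.1 (certParams x).2.2.1 (certParams x).2.2.2 &&
    certValue x.unpair.1 x.unpair.2.unpair.1 w.length (certParams x).2.1 (certParams x).2.2.1
      (stageFraction a q (certParams x).1 w (certParams x).1).1
      (stageFraction a q (certParams x).1 w (certParams x).1).2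

theorem computable_galeCert {f : ℕ → ℚ} (hf : Computable f) (a q : ℕ) :
    Computable₂ (galeCert f a q) := by
  have hx : Primrec fun y : List Bool × ℕ => certParams y.2 :=
    primrec_certParams.comp Primrec.snd
  have hT : Primrec fun y : List Bool × ℕ => (certParams y.2).2.1 :=
    Primrec.fst.comp (Primrec.snd.comp hx)
  have hB : Primrec fun y : List Bool × ℕ => (certParams y.2).2.2.1 :=
    Primrec.fst.comp (Primrec.snd.comp (Primrec.snd.comp hx))
  have hs : Primrec fun y : List Bool × ℕ => (certParams y.2).2.2.2 :=
    Primrec.snd.comp (Primrec.snd.comp (Primrec.snd.comp hx))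
  have h2s := Primrec.nat_pow.comp (Primrec.const 2) hs
  have h1 : Computable fun y : List Bool × ℕ => certExponent f (certParams y.2).2.1
      (certParams y.2).2.2.1 (certParams y.2).2.2.2 :=
    computable_natCast_lt_mul.comp (g := fun y : List Bool × ℕ =>
      (((certParams y.2).2.1 * 2 ^ (certParams y.2).2.2.2 + (certParams y.2).2.2.1,
        (certParams y.2).2.2.1 * 2 ^ (certParams y.2).2.2.2), f (certParams y.2).2.2.2))
      (((Primrec.nat_add.comp (Primrec.nat_mul.comp hT h2s) hB).pair
        (Primrec.nat_mul.comp hB h2s)).to_comp.pair (hf.comp hs.to_comp))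
  have hF : Primrec fun y : List Bool × ℕ =>
      stageFraction a q (certParams y.2).1 y.1 (certParams y.2).1 :=
    (primrec_stageFraction a q).comp ((Primrec.fst.comp hx).pair Primrec.fst)
  have hu : Primrec fun y : List Bool × ℕ => y.2.unpair.1 :=
    Primrec.fst.comp (Primrec.unpair.comp Primrec.snd)
  have hv : Primrec fun y : List Bool × ℕ => y.2.unpair.2.unpair.1 :=
    Primrec.fst.comp (Primrec.unpair.comp (Primrec.snd.comp (Primrec.unpair.comp Primrec.snd)))
  have h2 : Primrec fun y : List Bool × ℕ => certValue y.2.unpair.1 y.2.unpair.2.unpair.1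
      y.1.length (certParams y.2).2.1 (certParams y.2).2.2.1
      (stageFraction a q (certParams y.2).1 y.1 (certParams y.2).1).1
      (stageFraction a q (certParams y.2).1 y.1 (certParams y.2).1).2 :=
    (Primrec.nat_lt.comp
      (Primrec.nat_pow.comp (Primrec.nat_mul.comp hu
        (Primrec.nat_pow.comp (Primrec.const 2) (Primrec.snd.comp hF))) hB)
      (Primrec.nat_mul.comp
        (Primrec.nat_pow.comp (Primrec.const 2)
          (Primrec.nat_mul.comp hT (Primrec.list_length.comp Primrec.fst)))
        (Primrec.nat_pow.comp (Primrec.nat_mul.comp (Primrec.fst.comp hF)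
          (Primrec.nat_pow.comp (Primrec.const 2) hv)) hB))).decide
  exact Primrec.and.to_comp.comp h1 h2.to_comp

theorem certExponent_sound {t : ℝ} {f : ℕ → ℚ} (hf : ∀ n : ℕ, |(f n : ℝ) - t| ≤ 2 ^ (-(n : ℝ)))
    {T B s : ℕ} (h : certExponent f T B s = true) : 0 < B ∧ (T : ℝ) / B < t := by
  have h' : ((T * 2 ^ s + B : ℕ) : ℝ) < (B * 2 ^ s : ℕ) * (f s : ℝ) := by
    exact_mod_cast of_decide_eq_true h
  push_cast at h'
  have hB : 0 < B := by
    rcases Nat.eq_zero_or_pos B with rfl | hB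
    · exfalso
      have : (0 : ℝ) ≤ T * 2 ^ s := by positivity
      norm_num at h'
      linarith
    · exact hB
  refine ⟨hB, ?_⟩
  have hB' : (0 : ℝ) < B := by exact_mod_cast hB
  have h2 : (0 : ℝ) < 2 ^ s := by positivity
  have hfs := (abs_le.1 (hf s)).2
  rw [Real.rpow_neg zero_le_two, Real.rpow_natCast] at hfs
  rw [div_lt_iff₀ hB']
  have : (B * 2 ^ s : ℝ) * f s ≤ B * 2 ^ s * t + B := by
    have h3 : (B * 2 ^ s : ℝ) * f s ≤ B * 2 ^ s * (t + (2 ^ s)⁻¹) :=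
      mul_le_mul_of_nonneg_left (by linarith) (by positivity)
    have h4 : (B * 2 ^ s : ℝ) * (t + (2 ^ s)⁻¹) = B * 2 ^ s * t + B := by field_simp
    linarith
  have h5 : (T : ℝ) * 2 ^ s < (t * B) * 2 ^ s := by linarith
  exact lt_of_mul_lt_mul_right h5 h2.le

theorem exists_certExponent {t : ℝ} {f : ℕ → ℚ} (hf : ∀ n : ℕ, |(f n : ℝ) - t| ≤ 2 ^ (-(n : ℝ)))
    {T B : ℕ} (hB : 0 < B) (h : (T : ℝ) / B < t) : ∃ s, certExponent f T B s = true := by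
  have hB' : (0 : ℝ) < B := by exact_mod_cast hB
  obtain ⟨s, hs⟩ := exists_pow_lt_of_lt_one (half_pos (sub_pos.2 h)) (one_half_lt_one (α := ℝ))
  refine ⟨s, decide_eq_true ?_⟩
  have h2 : (0 : ℝ) < 2 ^ s := by positivity
  have hfs := (abs_le.1 (hf s)).1
  rw [Real.rpow_neg zero_le_two, Real.rpow_natCast] at hfs
  rw [one_div, inv_pow] at hs
  have h3 : (T : ℝ) / B + (2 ^ s)⁻¹ < f s := by linarith
  have h4 := mul_lt_mul_of_pos_left h3 (mul_pos hB' h2)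
  have h5 : (B * 2 ^ s : ℝ) * (T / B + (2 ^ s)⁻¹) = T * 2 ^ s + B := by field_simp
  rw [h5] at h4
  exact_mod_cast h4

theorem certValue_iff {u v n T B M E : ℕ} (hB : 0 < B) : certValue u v n T B M E = true ↔
    (u : ℝ) / 2 ^ v < 2 ^ ((T : ℝ) / B * n) * (M / 2 ^ E) := by
  have hB' : (B : ℝ) ≠ 0 := by exact_mod_cast hB.ne'
  have hpow : ((2 : ℝ) ^ ((T : ℝ) / B * n)) ^ B = 2 ^ (T * n) := by
    rw [← Real.rpow_natCast, ← Real.rpow_mul zero_le_two, ← Real.rpow_natCast]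
    congr 1
    push_cast
    field_simp
  have h1 : (u : ℝ) / 2 ^ v < 2 ^ ((T : ℝ) / B * n) * (M / 2 ^ E) ↔
      (u * 2 ^ E : ℝ) < 2 ^ ((T : ℝ) / B * n) * (M * 2 ^ v) := by
    rw [← mul_div_assoc, div_lt_div_iff₀ (by positivity) (by positivity), mul_assoc]
  rw [h1, ← pow_lt_pow_iff_left₀ (by positivity) (by positivity) hB.ne',
    mul_pow ((2 : ℝ) ^ ((T : ℝ) / B * n)) _ B, hpow,
    certValue, decide_eq_true_eq]
  exact_mod_cast Iff.rfl

theorem constructive_massGale {t : ℝ} (ht : 0 < t) (hct : ComputableReal t) (a : ℕ) {q : ℕ}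
    (hq : 0 < q) : Constructive (massGale t a q) := by
  obtain ⟨f, hfc, hf⟩ := hct
  refine Constructive.of_certificates (massGale_pos t a hq) (computable_galeCert hfc a q) ?_ ?_
  · intro w x hx
    simp only [galeCert, Bool.and_eq_true] at hx
    obtain ⟨hB, hT⟩ := certExponent_sound hf hx.1
    have hv := (certValue_iff hB).1 hx.2
    rw [stageFraction_eq] at hv
    have hd : (dyadicOf x : ℝ) = (x.unpair.1 : ℝ) / 2 ^ x.unpair.2.unpair.1 := by
      simp [dyadicOf]
    rw [hd]
    refine hv.trans_le (mul_le_mul ?_ (stageMass_le_limitMass a hq _ w)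
      (stageMass_pos a q _ w).le (by positivity))
    exact Real.rpow_le_rpow_of_exponent_le one_le_two
      (mul_le_mul_of_nonneg_right hT.le (Nat.cast_nonneg _))
  · intro w y hy0 hy
    have h1 : Tendsto (fun k => 2 ^ (t * w.length) * stageMass a q k w) atTop
        (nhds (massGale t a q w)) := (tendsto_stageMass a hq w).const_mul _
    obtain ⟨k, hk⟩ := (h1.eventually (lt_mem_nhds hy)).exists
    have h2 : Tendsto (fun z : ℝ => 2 ^ (z * w.length) * stageMass a q k w) (nhds t)
        (nhds (2 ^ (t * w.length) * stageMass a q k w)) := by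
      refine Continuous.tendsto (Continuous.mul ?_ continuous_const) t
      exact Real.continuous_const_rpow two_ne_zero |>.comp (continuous_id.mul continuous_const)
    have h3 := ((h2.eventually (lt_mem_nhds hk)).filter_mono nhdsWithin_le_nhds).and
      (Ioo_mem_nhdsLT ht)
    obtain ⟨l, hl, hlt⟩ := (mem_nhdsLT_iff_exists_Ioo_subset).1 h3
    obtain ⟨p, hp1, hp2⟩ := exists_rat_btwn (show l < t from hl)
    obtain ⟨hyp, hp0, -⟩ := hlt ⟨hp1, hp2⟩
    have hp0' : 0 ≤ p := by exact_mod_cast hp0.le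
    have hpe : (p : ℝ) = (p.num.natAbs : ℝ) / p.den := by
      have hn : (p.num.natAbs : ℤ) = p.num := Int.natAbs_of_nonneg (Rat.num_nonneg.2 hp0')
      have : ((p.num.natAbs : ℤ) : ℝ) = p.num := by rw [hn]
      rw [Int.cast_natCast] at this
      rw [this]
      exact Rat.cast_def p
    obtain ⟨s, hs⟩ := exists_certExponent hf p.den_pos (hpe ▸ hp2)
    obtain ⟨v, hv⟩ := exists_pow_lt_of_lt_one (sub_pos.2 hyp) (one_half_lt_one (α := ℝ))
    have h2v : (0 : ℝ) < 2 ^ v := by positivity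
    let u := ⌊y * 2 ^ v⌋₊ + 1
    have hu1 : y < (u : ℝ) / 2 ^ v := by
      rw [lt_div_iff₀ h2v]
      simp only [u]
      push_cast
      exact Nat.lt_floor_add_one (y * 2 ^ v)
    have hu2 : (u : ℝ) / 2 ^ v < 2 ^ ((p : ℝ) * w.length) * stageMass a q k w := by
      have : (u : ℝ) / 2 ^ v ≤ y + (1 / 2) ^ v := by
        rw [div_le_iff₀ h2v, add_mul, ← mul_pow]
        have := Nat.floor_le (a := y * 2 ^ v) (by positivity)
        simp only [u]
        push_cast
        norm_num
        linarith
      linarith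
    refine ⟨Nat.pair u (Nat.pair v (Nat.pair k (Nat.pair p.num.natAbs (Nat.pair p.den s)))), ?_, ?_⟩
    · simp only [galeCert, certParams, Nat.unpair_pair, Bool.and_eq_true]
      refine ⟨hs, (certValue_iff p.den_pos).2 ?_⟩
      rw [stageFraction_eq, ← hpe]
      exact hu2
    · simpa [dyadicOf] using hu1

theorem Supergale.sum_le {r : ℝ} {d : List Bool → ℝ} (hd : Supergale r d) (n : ℕ) :
    ∀ S : Finset (List Bool), (∀ v ∈ S, v.length = n) → ∑ v ∈ S, d v ≤ 2 ^ (r * n) * d [] := by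
  induction n with
  | zero =>
    intro S hS
    have hsub : S ⊆ {[]} := fun v hv => by
      simpa using hS v hv
    simpa using Finset.sum_le_sum_of_subset_of_nonneg hsub (f := d) fun v _ _ => hd.1 v
  | succ n ih =>
    intro S hS
    have hfib : ∀ u, ∑ v ∈ S with v.dropLast = u, d v ≤ 2 ^ r * d u := by
      intro u
      have hsub : S.filter (fun v => v.dropLast = u) ⊆ {u ++ [false], u ++ [true]} := by
        intro v hv
        obtain ⟨hvS, rfl⟩ := Finset.mem_filter.1 hv
        have hne : v ≠ [] := by
          rintro rfl
          simpa using hS _ hvS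
        have hv' := List.dropLast_append_getLast hne
        cases hb : v.getLast hne <;> rw [hb] at hv' <;> simp [hv']
      have h1 := Finset.sum_le_sum_of_subset_of_nonneg hsub (f := d) fun v _ _ => hd.1 v
      rw [Finset.sum_pair (by simp)] at h1
      have h2 := hd.2 u
      rw [div_le_iff₀ (by positivity)] at h2
      linarith
    rw [← Finset.sum_fiberwise_of_maps_to (t := S.image List.dropLast)
      (fun v hv => Finset.mem_image_of_mem _ hv)]
    calc _ ≤ ∑ u ∈ S.image List.dropLast, 2 ^ r * d u := Finset.sum_le_sum fun u _ => hfib u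
      _ = 2 ^ r * ∑ u ∈ S.image List.dropLast, d u := (Finset.mul_sum ..).symm
      _ ≤ 2 ^ r * (2 ^ (r * n) * d []) := by
        refine mul_le_mul_of_nonneg_left (ih _ fun u hu => ?_) (by positivity)
        obtain ⟨v, hv, rfl⟩ := Finset.mem_image.1 hu
        simp [hS v hv]
      _ = 2 ^ (r * (n + 1 : ℕ)) * d [] := by
        push_cast
        rw [mul_add, mul_one, Real.rpow_add two_pos]
        ring

theorem Supergale.card_le {r : ℝ} {d : List Bool → ℝ} (hd : Supergale r d) {C : ℝ} (hC : 0 < C)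
    (hdC : d [] ≤ C) {n : ℕ} {S : Finset (List Bool)} (hS : ∀ v ∈ S, v.length = n ∧ C < d v) :
    (S.card : ℝ) ≤ 2 ^ (r * n) := by
  have h1 := hd.sum_le n S fun v hv => (hS v hv).1
  have h2 := Finset.card_nsmul_le_sum S d C fun v hv => (hS v hv).2.le
  have h3 : (2 : ℝ) ^ (r * n) * d [] ≤ 2 ^ (r * n) * C :=
    mul_le_mul_of_nonneg_left hdC (by positivity)
  rw [nsmul_eq_mul] at h2
  exact le_of_mul_le_mul_right (by linarith) hC

/-- The binary string coded by the first component of `s`. -/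
def stringOf (s : ℕ) : List Bool := (decode s.unpair.1).getD []

/-- `s = ⟨v, k⟩` where `v` has length `n` and `k` is the first stage at which `h` exceeds `C`
at `v`. -/
def firstExceeds (h : List Bool × ℕ → ℚ) (C n s : ℕ) : Bool :=
  decide (encode (stringOf s) = s.unpair.1 ∧ (stringOf s).length = n) &&
    (decide ((C : ℚ) < h (stringOf s, s.unpair.2)) &&
      (decide (s.unpair.2 = 0) ||
        !decide ((C : ℚ) < h (stringOf s, s.unpair.2 - 1))))

theorem computable_firstExceeds {h : List Bool × ℕ → ℚ} (hh : Computable h) (C : ℕ) :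
    Computable₂ (firstExceeds h C) := by
  have hv : Primrec fun x : ℕ × ℕ => stringOf x.2 :=
    Primrec.option_getD.comp (Primrec.decode.comp
      (Primrec.fst.comp (Primrec.unpair.comp Primrec.snd))) (Primrec.const [])
  have hk : Primrec fun x : ℕ × ℕ => x.2.unpair.2 :=
    Primrec.snd.comp (Primrec.unpair.comp Primrec.snd)
  have hlt : Computable fun y : List Bool × ℕ => decide ((C : ℚ) < h y) := by
    refine (computable_natCast_lt_mul.comp (g := fun y : List Bool × ℕ => ((C, 1), h y))
      ((Computable.const _).pair hh)).of_eq fun y => ?_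
    simp
  have h1 : Primrec fun x : ℕ × ℕ =>
      decide (encode (stringOf x.2) = x.2.unpair.1 ∧ (stringOf x.2).length = x.1) :=
    ((Primrec.eq.comp (Primrec.encode.comp hv)
      (Primrec.fst.comp (Primrec.unpair.comp Primrec.snd))).and
      (Primrec.eq.comp (Primrec.list_length.comp hv) Primrec.fst)).decide
  have h2 : Computable fun x : ℕ × ℕ =>
      decide ((C : ℚ) < h (stringOf x.2, x.2.unpair.2)) :=
    hlt.comp (hv.pair hk).to_comp
  have h3 : Primrec fun x : ℕ × ℕ => decide (x.2.unpair.2 = 0) :=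
    (Primrec.eq.comp hk (Primrec.const 0)).decide
  have h4 : Computable fun x : ℕ × ℕ =>
      decide ((C : ℚ) < h (stringOf x.2, x.2.unpair.2 - 1)) :=
    hlt.comp (hv.pair (Primrec.nat_sub.comp hk (Primrec.const 1))).to_comp
  exact Primrec.and.to_comp.comp h1.to_comp (Primrec.and.to_comp.comp h2
    (Primrec.or.to_comp.comp h3.to_comp (Primrec.not.to_comp.comp h4)))

theorem firstExceeds_iff {h : List Bool × ℕ → ℚ} {C n s : ℕ} : firstExceeds h C n s = true ↔
    (encode (stringOf s) = s.unpair.1 ∧ (stringOf s).length = n) ∧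
      (C : ℚ) < h (stringOf s, s.unpair.2) ∧
      (s.unpair.2 = 0 ∨
        ¬ (C : ℚ) < h (stringOf s, s.unpair.2 - 1)) := by
  simp [firstExceeds]

theorem injOn_firstExceeds {h : List Bool × ℕ → ℚ} (hmono : ∀ w n, h (w, n) ≤ h (w, n + 1))
    (C n : ℕ) : Set.InjOn stringOf
      {s | firstExceeds h C n s = true} := by
  have key : ∀ s s', firstExceeds h C n s = true → firstExceeds h C n s' = true →
      stringOf s = stringOf s' →
      ¬ s.unpair.2 < s'.unpair.2 := by
    intro s s' hs hs' he hlt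
    rw [firstExceeds_iff] at hs hs'
    rw [← he] at hs'
    have hm := monotone_nat_of_le_succ (hmono (stringOf s))
      (show s.unpair.2 ≤ s'.unpair.2 - 1 by omega)
    rcases hs'.2.2 with h0 | h0
    · omega
    · exact h0 (hs.2.1.trans_le hm)
  intro s hs s' hs' he
  have h2 : s.unpair.2 = s'.unpair.2 :=
    le_antisymm (not_lt.1 (key _ _ hs' hs he.symm)) (not_lt.1 (key _ _ hs hs' he))
  have h1 : s.unpair.1 = s'.unpair.1 := by
    rw [← (firstExceeds_iff.1 hs).1.1, ← (firstExceeds_iff.1 hs').1.1]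
    exact congrArg encode he
  rw [← Nat.pair_unpair s, ← Nat.pair_unpair s', h1, h2]

/-- One program lists, for each length `n`, the strings of length `n` at which a constructive
`r`-supergale is large, with indices below `2 ^ (r * n)`. -/
theorem Supergale.exists_code {r : ℝ} {d : List Bool → ℝ} (hd : Supergale r d)
    (hcd : Constructive d) : ∃ (C : ℝ) (c : Nat.Partrec.Code), ∀ v, C < d v →
      ∃ i : ℕ, (i : ℝ) < 2 ^ (r * v.length) ∧ encode v ∈ c.eval (Nat.pair v.length i) := by
  obtain ⟨h, hhc, hh, hsup⟩ := hcd
  obtain ⟨C, hC⟩ := exists_nat_gt (d [])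
  have hC0 : (0 : ℝ) < C := (hd.1 []).trans_lt hC
  have hacc := computable_firstExceeds hhc C
  have hp : Computable₂ fun p s : ℕ => firstExceeds h C p.unpair.1 s &&
      decide (Nat.count (fun x => firstExceeds h C p.unpair.1 x = true) s = p.unpair.2) := by
    have hn : Computable fun x : ℕ × ℕ => x.1.unpair.1 :=
      (Primrec.fst.comp (Primrec.unpair.comp Primrec.fst)).to_comp
    have hi : Computable fun x : ℕ × ℕ => x.1.unpair.2 :=
      (Primrec.snd.comp (Primrec.unpair.comp Primrec.fst)).to_comp
    exact Primrec.and.to_comp.comp (hacc.comp hn Computable.snd)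
      (Primrec.eq.decide.to_comp.comp
        ((Computable.nat_count hacc).comp hn Computable.snd) hi)
  have hprog : Partrec fun p : ℕ => (Nat.rfind fun s => Part.some (firstExceeds h C p.unpair.1 s &&
      decide (Nat.count (fun x => firstExceeds h C p.unpair.1 x = true) s = p.unpair.2))).map
        fun s => s.unpair.1 :=
    (Partrec.rfind hp.partrec₂).map
      (Primrec.fst.comp (Primrec.unpair.comp Primrec.snd)).to_comp
  obtain ⟨c, hc⟩ := Nat.Partrec.Code.exists_code.1 (Partrec.nat_iff.1 hprog)
  refine ⟨C, c, fun v hv => ?_⟩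
  have hex : ∃ k, (C : ℚ) < h (v, k) := by
    rw [hsup] at hv
    obtain ⟨k, hk⟩ := exists_lt_of_lt_ciSup hv
    exact ⟨k, by exact_mod_cast hk⟩
  have hs : firstExceeds h C v.length (Nat.pair (encode v) (Nat.find hex)) = true := by
    rw [firstExceeds_iff]
    simp only [stringOf, Nat.unpair_pair, Encodable.encodek, Option.getD_some, and_self, true_and]
    refine ⟨Nat.find_spec hex, ?_⟩
    rcases Nat.eq_zero_or_pos (Nat.find hex) with h0 | h0
    · exact Or.inl h0
    · exact Or.inr (Nat.find_min hex (Nat.sub_lt h0 one_pos))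
  set s := Nat.pair (encode v) (Nat.find hex)
  refine ⟨Nat.count (fun x => firstExceeds h C v.length x = true) s, ?_, ?_⟩
  · have hcard := hd.card_le hC0 hC.le (n := v.length)
      (S := ((Finset.range (s + 1)).filter fun x => firstExceeds h C v.length x = true).image
        stringOf) (by
        intro u hu
        obtain ⟨x, hx, rfl⟩ := Finset.mem_image.1 hu
        have hx' := firstExceeds_iff.1 (Finset.mem_filter.1 hx).2
        refine ⟨hx'.1.2, lt_trans ?_ (hh _ x.unpair.2).2⟩
        exact_mod_cast hx'.2.1)
    have hinj := (injOn_firstExceeds (fun w n => (hh w n).1) C v.length).mono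
      (s₁ := ↑((Finset.range (s + 1)).filter fun x => firstExceeds h C v.length x = true))
      fun x hx => (Finset.mem_filter.1 (Finset.mem_coe.1 hx)).2
    rw [Finset.card_image_of_injOn hinj, ← Nat.count_eq_card_filter_range, Nat.count_succ,
      if_pos hs] at hcard
    push_cast at hcard
    linarith
  · rw [hc]
    refine (Part.mem_map_iff _).2 ⟨s, Nat.mem_rfind.2 ⟨?_, fun {m} hm => ?_⟩, by simp [s]⟩
    · simp [hs]
    · simp only [Nat.unpair_pair, Part.mem_some_iff]
      refine (Bool.eq_false_iff.2 fun hm' => ?_).symm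
      simp only [Bool.and_eq_true, decide_eq_true_eq] at hm'
      exact hm.ne (Nat.count_injective hm'.1 hs hm'.2)

theorem le_massGale {r t : ℝ} {a q : ℕ} (hq : 0 < q) (hra : r ≤ a / q) {c : Nat.Partrec.Code}
    {v : List Bool} {i : ℕ} (hi : (i : ℝ) < 2 ^ (r * v.length))
    (hv : encode v ∈ c.eval (Nat.pair v.length i)) :
    (2 : ℝ) ^ ((t - (a + 1) / q) * v.length - encode c) ≤ massGale t a q v := by
  have hq' : (0 : ℝ) < q := by exact_mod_cast hq
  obtain ⟨k, hk⟩ := Nat.Partrec.Code.evaln_complete.1 hv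
  let j := Nat.pair (encode c) (Nat.pair v.length i)
  have hout : progOut (max k (j + 1)) j = some v := by
    refine progOut_mono (le_max_left _ _) ?_
    rw [progOut, Option.bind_eq_some_iff]
    exact ⟨encode v, by simpa [j] using hk, Encodable.encodek v⟩
  have hi' : i < 2 ^ (a * v.length / q + 1) := by
    have h1 : r * v.length ≤ ((a * v.length / q + 1 : ℕ) : ℝ) := by
      have h2 : (a * v.length : ℝ) ≤ q * (a * v.length / q + 1 : ℕ) := by
        exact_mod_cast (Nat.lt_mul_of_div_lt (Nat.lt_succ_self _) hq).le.trans_eq (mul_comm _ _)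
      calc r * v.length ≤ a / q * v.length := mul_le_mul_of_nonneg_right hra (Nat.cast_nonneg _)
        _ = a * v.length / q := by ring
        _ ≤ _ := by rw [div_le_iff₀ hq']; linarith
    have h2 := hi.trans_le (Real.rpow_le_rpow_of_exponent_le one_le_two h1)
    rw [Real.rpow_natCast] at h2
    exact_mod_cast h2
  have hch : charges a q (max k (j + 1)) j v = true := by
    simp only [charges, Bool.and_eq_true, decide_eq_true_eq, hout, Option.map_some,
      preSeq_padZero, and_true]
    simpa [j] using hi'
  have hmass : (1 / 2 : ℝ) ^ chargeExp a q j ≤ limitMass a q v := by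
    refine le_trans ?_ (stageMass_le_limitMass a hq (max k (j + 1)) v)
    have h1 := Finset.single_le_sum (f := fun j' => charge a q (max k (j + 1)) j' v)
      (fun j' _ => charge_nonneg ..)
      (Finset.mem_range.2 (lt_of_lt_of_le (Nat.lt_succ_self j) (le_max_right k (j + 1))))
    have h2 : (0 : ℝ) < (1 / 2) ^ v.length := by positivity
    simp only [charge, hch, if_true] at h1
    simp only [stageMass, charge]
    linarith
  have hexp : (chargeExp a q j : ℝ) ≤ encode c + (a + 1) / q * v.length := by
    have h1 := Nat.cast_div_le (α := ℝ) (m := a * v.length) (n := q)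
    have h2 := Nat.cast_div_le (α := ℝ) (m := v.length) (n := q)
    simp only [chargeExp, j, Nat.unpair_pair]
    push_cast at h1 ⊢
    have h3 : ((a : ℝ) + 1) / q * v.length = a * v.length / q + v.length / q := by ring
    linarith
  calc (2 : ℝ) ^ ((t - (a + 1) / q) * v.length - encode c)
      ≤ 2 ^ (t * v.length + -(chargeExp a q j : ℝ)) :=
        Real.rpow_le_rpow_of_exponent_le one_le_two (by linarith)
    _ = 2 ^ (t * v.length) * (1 / 2) ^ chargeExp a q j := by
        rw [Real.rpow_add two_pos, Real.rpow_neg zero_le_two, Real.rpow_natCast, one_div, inv_pow]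
    _ ≤ massGale t a q v := mul_le_mul_of_nonneg_left hmass (by positivity)

theorem successSet_subset_massGale {r t : ℝ} {a q : ℕ} (hq : 0 < q) (hra : r ≤ a / q)
    (hat : (a + 1) / q < t) {d : List Bool → ℝ} (hd : Supergale r d) (hcd : Constructive d) :
    SuccessSet d ⊆ SuccessSet (massGale t a q) := by
  obtain ⟨C, c, hc⟩ := hd.exists_code hcd
  intro S hS
  have hfreq : ∃ᶠ n in atTop, C < d (preSeq S n) := by
    have h : ((C : ℝ) : EReal) < limsup (fun n => ((d (preSeq S n) : ℝ) : EReal)) atTop := by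
      rw [show limsup _ _ = ⊤ from hS]
      exact EReal.coe_lt_top C
    exact (frequently_lt_of_lt_limsup (by isBoundedDefault) h).mono fun n hn => by
      exact_mod_cast hn
  have hgrow : Tendsto (fun n : ℕ => (2 : ℝ) ^ ((t - (a + 1) / q) * n - encode c)) atTop atTop :=
    (tendsto_rpow_atTop_of_base_gt_one 2 one_lt_two).comp
      (tendsto_atTop_add_const_right _ _
        (tendsto_natCast_atTop_atTop.const_mul_atTop (sub_pos.2 hat)))
  refine (EReal.eq_top_iff_forall_lt _).2 fun M => ?_
  have hM : ((M : ℝ) : EReal) < ((M + 1 : ℝ) : EReal) := by exact_mod_cast lt_add_one M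
  refine hM.trans_le (le_limsup_of_frequently_le ?_ (by isBoundedDefault))
  refine (hfreq.and_eventually (hgrow.eventually_ge_atTop (M + 1))).mono fun n hn => ?_
  obtain ⟨i, hi, hv⟩ := hc _ hn.1
  have := le_massGale (t := t) hq hra hi hv
  rw [length_preSeq] at this
  exact_mod_cast hn.2.trans this

theorem exists_rational_gap {r t : ℝ} (hr : 0 ≤ r) (hrt : r < t) :
    ∃ a q : ℕ, 0 < q ∧ r ≤ a / q ∧ ((a : ℝ) + 1) / q < t := by
  obtain ⟨q, hq⟩ := exists_nat_gt (2 / (t - r))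
  have hq0 : (0 : ℝ) < q := (div_pos two_pos (sub_pos.2 hrt)).trans hq
  rw [div_lt_iff₀ (sub_pos.2 hrt)] at hq
  refine ⟨⌈r * q⌉₊, q, by exact_mod_cast hq0, ?_, ?_⟩
  · rw [le_div_iff₀ hq0]
    exact Nat.le_ceil _
  · rw [div_lt_iff₀ hq0]
    have := Nat.ceil_lt_add_one (mul_nonneg hr hq0.le)
    linarith

/-- For computable reals `t > r ≥ 0` there is a constructive `t`-gale that is
successively optimal for the class of constructive `r`-supergales. -/
theorem exists_successively_optimal_gale (r t : ℝ) (hr : 0 ≤ r) (hrt : r < t)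
    (hcr : ComputableReal r) (hct : ComputableReal t) :
    ∃ d' : List Bool → ℝ, Gale t d' ∧ Constructive d' ∧
      ∀ d : List Bool → ℝ, Supergale r d → Constructive d →
        SuccessSet d ⊆ SuccessSet d' := by
  obtain ⟨a, q, hq, hra, hat⟩ := exists_rational_gap hr hrt
  exact ⟨massGale t a q, gale_massGale t a hq, constructive_massGale (hr.trans_lt hrt) hct a hq,
    fun d hd hcd => successSet_subset_massGale hq hra hat hd hcd⟩
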